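/- Let H₁, H₂ be complex Hilbert spaces of finite dimensions d₁ ≥ d₂ > 1, H = H₁⊗H₂, ψ ∈ H a unit vector, and let C_ψ = Conv(K·P_ψ) be the convex hull of the orbit of P_ψ under the local unitary group K = U(H₁)×U(H₂). Then: (i) C_ψ is K-invariant; (ii) C_ψ is contained in the set D(H) of density states inside the affine space u*₁(H) of trace-one Hermitian operators; (iii) 𝕀_H = I_H/(d₁d₂) belongs to C_ψ; and (iv) if ψ is not maximally entangled, then C_ψ is a convex body in u*₁(H), i.e., has nonempty interior in u*₁(H). -/

import Mathlib

open Matrix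
open scoped Kronecker ComplexOrder

noncomputable section

/-- The pure state (rank-one projection) `|ψ⟩⟨ψ|` associated with a vector `ψ`. -/
def pureState {n : Type*} [Fintype n] (ψ : n → ℂ) : Matrix n n ℂ :=
  Matrix.vecMulVec ψ (star ψ)

/-- `ψ` is a unit vector. -/
def IsUnitVec {n : Type*} [Fintype n] (ψ : n → ℂ) : Prop :=
  ∑ p, Complex.normSq (ψ p) = 1

/-- A family of vectors is an orthonormal system. -/
def ONFamily {ι n : Type*} [DecidableEq ι] [Fintype n] (v : ι → n → ℂ) : Prop :=
  ∀ i j, (∑ p, (starRingEnd ℂ) (v i p) * v j p) = if i = j then 1 else 0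

/-- Maximally entangled unit vector in `H₁ ⊗ H₂`, `dim H₁ = d₁ ≥ dim H₂ = d₂`. -/
def MaxEnt (d₁ d₂ : ℕ) (ψ : Fin d₁ × Fin d₂ → ℂ) : Prop :=
  ∃ (a : Fin d₂ → Fin d₁ → ℂ) (b : Fin d₂ → Fin d₂ → ℂ),
    ONFamily a ∧ ONFamily b ∧
    ∀ p, ψ p = ((Real.sqrt d₂ : ℂ))⁻¹ * ∑ j, a j p.1 * b j p.2

/-- The orbit of a Hermitian operator `A` on `H₁ ⊗ H₂` under the local unitary group
`K = U(H₁) × U(H₂)` acting by `(U₁,U₂)·A = (U₁ ⊗ U₂) A (U₁ ⊗ U₂)†`. -/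
def localOrbit (d₁ d₂ : ℕ) (A : Matrix (Fin d₁ × Fin d₂) (Fin d₁ × Fin d₂) ℂ) :
    Set (Matrix (Fin d₁ × Fin d₂) (Fin d₁ × Fin d₂) ℂ) :=
  {B | ∃ U₁ ∈ Matrix.unitaryGroup (Fin d₁) ℂ, ∃ U₂ ∈ Matrix.unitaryGroup (Fin d₂) ℂ,
    B = (U₁ ⊗ₖ U₂) * A * (U₁ ⊗ₖ U₂)ᴴ}

/-- The affine space `u*₁(H)` of trace-one Hermitian operators on `H`. -/
def traceOne (n : Type*) [Fintype n] [DecidableEq n] : Set (Matrix n n ℂ) :=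
  {A | A.IsHermitian ∧ A.trace = 1}

/-- A subspace of an algebra stable under commutators with the elements of the range of `f`. -/
def AdStable {A B : Type*} [Ring B] [Module ℂ B] (f : A → B) (S : Submodule ℂ B) : Prop :=
  ∀ Y, ∀ X ∈ S, f Y * X - X * f Y ∈ S

lemma Submodule.sandwich_mem_of_sq_eq_zero {B : Type*} [Ring B] [Algebra ℂ B]
    {S : Submodule ℂ B} {N X : B} (hS : ∀ X ∈ S, N * X - X * N ∈ S) (hN : N * N = 0)
    (hX : X ∈ S) : N * X * N ∈ S := by
  have h := S.smul_mem (-(1 / 2) : ℂ) (hS _ (hS X hX))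
  have e : N * (N * X - X * N) - (N * X - X * N) * N = (-2 : ℂ) • (N * X * N) := by
    have h1 : N * (N * X) = 0 := by rw [← mul_assoc, hN, zero_mul]
    have h2 : X * N * N = 0 := by rw [mul_assoc, hN, mul_zero]
    rw [mul_sub, sub_mul, h1, h2, ← mul_assoc, neg_smul, two_smul]
    abel
  rw [e, smul_smul] at h
  norm_num at h
  exact h

section AdStable

variable {n : Type*} [Fintype n] [DecidableEq n] {S : Submodule ℂ (Matrix n n ℂ)}

lemma AdStable.exists_single_mem (hS : AdStable id S) {X : Matrix n n ℂ} (hX : X ∈ S)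
    (hns : ¬ ∃ c : ℂ, X = c • 1) : ∃ i j, i ≠ j ∧ single i j (1 : ℂ) ∈ S := by
  by_cases hoff : ∃ i j, i ≠ j ∧ X i j ≠ 0
  · obtain ⟨i, j, hij, hx⟩ := hoff
    refine ⟨j, i, hij.symm, ?_⟩
    have h := Submodule.sandwich_mem_of_sq_eq_zero (hS (single j i (1 : ℂ)))
      (by simp [hij]) hX
    rw [id, single_mul_mul_single] at h
    have h' := S.smul_mem (X i j)⁻¹ h
    rw [smul_single] at h'
    simpa [hx] using h'
  · push Not at hoff
    have hdiag : ∃ i j, X i i ≠ X j j := by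
      by_contra! hall
      apply hns
      rcases isEmpty_or_nonempty n with he | ⟨⟨k⟩⟩
      · exact ⟨0, by ext i; exact he.elim i⟩
      · refine ⟨X k k, ?_⟩
        ext i j
        by_cases hij : i = j
        · subst hij; simp [hall i k]
        · simp [hij, hoff i j hij]
    obtain ⟨i, j, hij⟩ := hdiag
    have hne : i ≠ j := by rintro rfl; exact hij rfl
    refine ⟨i, j, hne, ?_⟩
    have h := S.smul_mem (X j j - X i i)⁻¹ (hS (single i j 1) X hX)
    have e : id (single i j (1 : ℂ)) * X - X * id (single i j 1)
        = (X j j - X i i) • single i j 1 := by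
      have hd : X = diagonal fun k => X k k := by
        ext k l
        by_cases hkl : k = l
        · subst hkl; simp
        · simp [hkl, hoff k l hkl]
      rw [hd]
      ext k l
      simp only [id, Matrix.sub_apply, mul_diagonal, diagonal_mul, Matrix.smul_apply, single_apply,
        diagonal_apply_eq]
      split_ifs with hkl
      · obtain ⟨rfl, rfl⟩ := hkl; simp
      · simp
    rw [e, smul_smul, inv_mul_cancel₀ (sub_ne_zero.2 hij.symm), one_smul] at h
    exact h

lemma AdStable.single_mem (hS : AdStable id S) {i j : n} (hij : i ≠ j)
    (h : single i j (1 : ℂ) ∈ S) {k l : n} (hkl : k ≠ l) : single k l (1 : ℂ) ∈ S := by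
  have left : ∀ {i j : n}, i ≠ j → single i j (1 : ℂ) ∈ S →
      ∀ k, k ≠ j → single k j (1 : ℂ) ∈ S := by
    intro i j hij h k hk
    have := hS (single k i 1) _ h
    simpa [single_mul_single_of_ne _ _ _ _ hk.symm] using this
  have right : ∀ {i j : n}, i ≠ j → single i j (1 : ℂ) ∈ S →
      ∀ l, i ≠ l → single i l (1 : ℂ) ∈ S := by
    intro i j hij h l hl
    have := S.neg_mem (hS (single j l 1) _ h)
    simpa [single_mul_single_of_ne _ _ _ _ hl.symm] using this
  by_cases hil : i = l
  · subst hil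
    have hji : single j i (1 : ℂ) ∈ S := by
      have := Submodule.sandwich_mem_of_sq_eq_zero (hS (single j i (1 : ℂ)))
        (by simp [hij]) h
      simpa using this
    exact left hij.symm hji k hkl
  · exact left hil (right hij h l hil) k hkl

lemma AdStable.mem_of_trace_eq_zero (hS : AdStable id S) {X : Matrix n n ℂ} (hX : X ∈ S)
    (hns : ¬ ∃ c : ℂ, X = c • 1) {C : Matrix n n ℂ} (hC : C.trace = 0) : C ∈ S := by
  obtain ⟨i, j, hij, hE⟩ := hS.exists_single_mem hX hns
  have hoff : ∀ {k l : n}, k ≠ l → single k l (1 : ℂ) ∈ S := hS.single_mem hij hE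
  have hdiag : ∀ k, single k k (1 : ℂ) - single i i 1 ∈ S := by
    intro k
    by_cases hki : k = i
    · simp [hki]
    · simpa using hS (single k i 1) _ (hoff (Ne.symm hki))
  have e : C = ∑ k, ∑ l, C k l • (single k l (1 : ℂ) - if k = l then single i i 1 else 0) := by
    simp only [smul_sub, Finset.sum_sub_distrib, smul_ite, smul_zero, Finset.sum_ite_eq,
      Finset.mem_univ, if_true, ← Finset.sum_smul]
    rw [show ∑ k, C k k = 0 from hC, zero_smul, sub_zero]
    conv_lhs => rw [matrix_eq_sum_single C]
    simp
  rw [e]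
  refine S.sum_mem fun k _ => S.sum_mem fun l _ => S.smul_mem _ ?_
  split_ifs with hkl
  · subst hkl; exact hdiag k
  · simpa using hoff hkl

lemma AdStable.mem_of_one_mem (hS : AdStable id S) {X : Matrix n n ℂ} (hX : X ∈ S)
    (hns : ¬ ∃ c : ℂ, X = c • 1) (h1 : (1 : Matrix n n ℂ) ∈ S) (C : Matrix n n ℂ) : C ∈ S := by
  have hcard : (Fintype.card n : ℂ) ≠ 0 := by
    intro h
    rw [Nat.cast_eq_zero, Fintype.card_eq_zero_iff] at h
    exact hns ⟨0, by ext i; exact h.elim i⟩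
  have h := S.add_mem (hS.mem_of_trace_eq_zero hX hns
    (C := C - (C.trace / Fintype.card n) • 1) (by simp [hcard]))
    (S.smul_mem (C.trace / Fintype.card n) h1)
  rwa [sub_add_cancel] at h

end AdStable

section Twirl

lemma sum_intUnits_mul_eq_ite {n : Type*} [Fintype n] [DecidableEq n] (i j : n) :
    ∑ s : n → ℤˣ, (((s i : ℤ) : ℂ) * ((s j : ℤ) : ℂ)) =
      if i = j then (Fintype.card (n → ℤˣ) : ℂ) else 0 := by
  split_ifs with h
  · subst h
    have : ∀ s : n → ℤˣ, (((s i : ℤ) : ℂ) * ((s i : ℤ) : ℂ)) = 1 := by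
      intro s
      rcases Int.units_eq_one_or (s i) with h | h <;> simp [h]
    simp [this]
  · have key := Equiv.sum_comp (Equiv.mulLeft (Pi.mulSingle i (-1 : ℤˣ)))
      fun s : n → ℤˣ => (((s i : ℤ) : ℂ) * ((s j : ℤ) : ℂ))
    simp only [Equiv.coe_mulLeft, Pi.mul_apply, Pi.mulSingle_eq_same,
      Pi.mulSingle_eq_of_ne (Ne.symm h), one_mul, Units.val_neg,
      Int.cast_neg, neg_mul, Finset.sum_neg_distrib] at key
    linear_combination (-1 / 2 : ℂ) * key

/-- There is a finite family of unitaries whose averaged conjugation is the completely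
depolarizing map. -/
lemma exists_unitary_twirl (d : ℕ) [NeZero d] :
    ∃ (ι : Type) (_ : Fintype ι) (_ : Nonempty ι) (U : ι → Matrix (Fin d) (Fin d) ℂ),
      (∀ k, U k ∈ Matrix.unitaryGroup (Fin d) ℂ) ∧
      ∀ X, ∑ k, U k * X * (U k)ᴴ = (Fintype.card ι / d * X.trace : ℂ) • 1 := by
  let U : (Fin d → ℤˣ) × Fin d → Matrix (Fin d) (Fin d) ℂ := fun p =>
    of fun i j => if i + p.2 = j then (((p.1 i : ℤ) : ℂ)) else 0
  have hU : ∀ p (X : Matrix (Fin d) (Fin d) ℂ) i j, (U p * X * (U p)ᴴ) i j =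
      (((p.1 i : ℤ) : ℂ) * ((p.1 j : ℤ) : ℂ)) * X (i + p.2) (j + p.2) := by
    intro p X i j
    simp [U, mul_apply, apply_ite]
    ring
  refine ⟨(Fin d → ℤˣ) × Fin d, inferInstance, inferInstance, U, fun p => ?_, fun X => ?_⟩
  · rw [mem_unitaryGroup_iff, star_eq_conjTranspose]
    have := hU p 1
    rw [mul_one] at this
    ext i j
    rw [this]
    by_cases h : i = j
    · subst h
      rcases Int.units_eq_one_or (p.1 i) with h | h <;> simp [h]
    · simp [h]
  · ext i j
    rw [Matrix.sum_apply]
    simp_rw [hU]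
    rw [Fintype.sum_prod_type_right]
    simp_rw [← Finset.sum_mul, sum_intUnits_mul_eq_ite]
    rw [← Finset.mul_sum]
    have hd : (d : ℂ) ≠ 0 := NeZero.ne _
    by_cases h : i = j
    · subst h
      have := Equiv.sum_comp (Equiv.addLeft i) fun k => X k k
      simp only [Equiv.coe_addLeft] at this
      rw [this]
      simp [trace]
    · simp [h]

end Twirl

section Bipartite

lemma Matrix.kronecker_sum {ι l m n p : Type*} (s : Finset ι) (A : Matrix l m ℂ)
    (B : ι → Matrix n p ℂ) : A ⊗ₖ (∑ k ∈ s, B k) = ∑ k ∈ s, A ⊗ₖ B k := by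
  ext; simp [Matrix.sum_apply, Finset.mul_sum]

lemma Matrix.sum_kronecker {ι l m n p : Type*} (s : Finset ι) (A : ι → Matrix l m ℂ)
    (B : Matrix n p ℂ) : (∑ k ∈ s, A k) ⊗ₖ B = ∑ k ∈ s, A k ⊗ₖ B := by
  ext; simp [Matrix.sum_apply, Finset.sum_mul]

variable {m n : Type*} [Fintype m] [Fintype n] [DecidableEq m] [DecidableEq n]

lemma Matrix.kronecker_induction {p : Matrix (m × n) (m × n) ℂ → Prop}
    (hadd : ∀ S T, p S → p T → p (S + T)) (hkron : ∀ A B, p (A ⊗ₖ B))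
    (T : Matrix (m × n) (m × n) ℂ) : p T := by
  induction T using Matrix.induction_on' with
  | h_zero => simpa using hkron 0 0
  | h_add S T hS hT => exact hadd S T hS hT
  | h_std_basis i j c =>
    have := hkron (single i.1 j.1 c) (single i.2 j.2 1)
    rwa [single_kronecker_single, mul_one] at this

/-- Partial trace over the second tensor factor. -/
def partialTraceRight (T : Matrix (m × n) (m × n) ℂ) : Matrix m m ℂ :=
  of fun i j => ∑ k, T (i, k) (j, k)

/-- Partial trace over the first tensor factor. -/
def partialTraceLeft (T : Matrix (m × n) (m × n) ℂ) : Matrix n n ℂ :=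
  of fun k l => ∑ i, T (i, k) (i, l)

lemma sum_conj_kronecker_eq_smul_one {ι κ : Type*} [Fintype ι] [Fintype κ]
    {U : ι → Matrix m m ℂ} {V : κ → Matrix n n ℂ} {a b : ℂ}
    (hU : ∀ X, ∑ k, U k * X * (U k)ᴴ = (a * X.trace) • 1)
    (hV : ∀ X, ∑ k, V k * X * (V k)ᴴ = (b * X.trace) • 1) (T : Matrix (m × n) (m × n) ℂ) :
    ∑ k, ∑ l, (U k ⊗ₖ V l) * T * (U k ⊗ₖ V l)ᴴ = (a * b * T.trace) • 1 := by
  induction T using Matrix.kronecker_induction with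
  | hadd S T hS hT =>
    simp only [mul_add, add_mul, Finset.sum_add_distrib, hS, hT, trace_add, add_smul]
  | hkron A B =>
    simp only [conjTranspose_kronecker, ← mul_kronecker_mul,
      ← kronecker_sum, ← sum_kronecker, hU, hV]
    rw [smul_kronecker, kronecker_smul, smul_smul, one_kronecker_one, trace_kronecker]
    congr 1; ring

lemma sum_conj_one_kronecker {κ : Type*} [Fintype κ] {V : κ → Matrix n n ℂ} {b : ℂ}
    (hV : ∀ X, ∑ k, V k * X * (V k)ᴴ = (b * X.trace) • 1) (T : Matrix (m × n) (m × n) ℂ) :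
    ∑ l, ((1 : Matrix m m ℂ) ⊗ₖ V l) * T * (1 ⊗ₖ V l)ᴴ =
      b • (partialTraceRight T ⊗ₖ (1 : Matrix n n ℂ)) := by
  induction T using Matrix.kronecker_induction with
  | hadd S T hS hT =>
    have : partialTraceRight (S + T) = partialTraceRight S + partialTraceRight T := by
      ext; simp [partialTraceRight, Finset.sum_add_distrib]
    simp only [mul_add, add_mul, Finset.sum_add_distrib, hS, hT, this, add_kronecker, smul_add]
  | hkron A B =>
    have : partialTraceRight (A ⊗ₖ B) = B.trace • A := by
      ext; simp [partialTraceRight, trace, ← Finset.mul_sum, mul_comm]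
    simp only [conjTranspose_kronecker, ← mul_kronecker_mul,
      ← kronecker_sum, hV, this, conjTranspose_one,
      one_mul, mul_one, smul_kronecker, kronecker_smul, smul_smul]

lemma sum_conj_kronecker_one {ι : Type*} [Fintype ι] {U : ι → Matrix m m ℂ} {a : ℂ}
    (hU : ∀ X, ∑ k, U k * X * (U k)ᴴ = (a * X.trace) • 1) (T : Matrix (m × n) (m × n) ℂ) :
    ∑ k, (U k ⊗ₖ (1 : Matrix n n ℂ)) * T * (U k ⊗ₖ 1)ᴴ =
      a • ((1 : Matrix m m ℂ) ⊗ₖ partialTraceLeft T) := by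
  induction T using Matrix.kronecker_induction with
  | hadd S T hS hT =>
    have : partialTraceLeft (S + T) = partialTraceLeft S + partialTraceLeft T := by
      ext; simp [partialTraceLeft, Finset.sum_add_distrib]
    simp only [mul_add, add_mul, Finset.sum_add_distrib, hS, hT, this, kronecker_add, smul_add]
  | hkron A B =>
    have : partialTraceLeft (A ⊗ₖ B) = A.trace • B := by
      ext; simp [partialTraceLeft, trace, ← Finset.sum_mul]
    simp only [conjTranspose_kronecker, ← mul_kronecker_mul,
      ← sum_kronecker, hU, this, conjTranspose_one,
      one_mul, mul_one, smul_kronecker, kronecker_smul, smul_smul]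

end Bipartite

section Unitary

lemma Submodule.mem_of_projection_mem {n : Type*} [Fintype n] [DecidableEq n]
    {S : Submodule ℂ (Matrix n n ℂ)}
    (h : ∀ P : Matrix n n ℂ, P.IsHermitian → P * P = P → P ∈ S) (Y : Matrix n n ℂ) : Y ∈ S := by
  have hdiag : ∀ i, single i i (1 : ℂ) ∈ S := fun i => by
    refine h _ ?_ (by simp)
    rw [IsHermitian, conjTranspose_single, star_one]
  have hoff : ∀ i j, i ≠ j → ∀ w : ℂ, w * star w = 1 →
      w • single i j (1 : ℂ) + star w • single j i 1 ∈ S := by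
    intro i j hij w hw
    have hP := h ((1 / 2 : ℂ) • (single i i 1 + single j j 1 + w • single i j (1 : ℂ)
      + star w • single j i 1)) (by
        simp only [IsHermitian, conjTranspose_smul, conjTranspose_add, conjTranspose_single,
          star_one, star_star]
        norm_num
        abel) (by
        simp only [mul_add, add_mul, single_mul_single_same, mul_smul_comm,
          smul_mul_assoc, single_mul_single_of_ne _ _ _ _ hij,
          single_mul_single_of_ne _ _ _ _ hij.symm, smul_smul, mul_one, smul_zero,
          add_zero, zero_add]
        match_scalars <;> first | ring1 | linear_combination (1 / 4 : ℂ) * hw)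
    have := S.sub_mem (S.smul_mem (2 : ℂ) hP) (S.add_mem (hdiag i) (hdiag j))
    rw [smul_smul, show (2 : ℂ) * (1 / 2) = 1 by norm_num, one_smul] at this
    convert this using 1
    abel
  have hsingle : ∀ i j, single i j (1 : ℂ) ∈ S := by
    intro i j
    by_cases hij : i = j
    · subst hij; exact hdiag i
    · have h1 := hoff i j hij 1 (by simp)
      have h2 := hoff i j hij Complex.I (by simp)
      have := S.smul_mem (1 / 2 : ℂ) (S.sub_mem h1 (S.smul_mem Complex.I h2))
      convert this using 1
      have e : star Complex.I = -Complex.I := by simp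
      rw [e, smul_add, smul_smul, smul_smul, mul_neg, Complex.I_mul_I, star_one]
      module
  rw [matrix_eq_sum_single Y]
  refine S.sum_mem fun i _ => S.sum_mem fun j _ => ?_
  have := S.smul_mem (Y i j) (hsingle i j)
  rwa [smul_single, smul_eq_mul, mul_one] at this

lemma one_add_smul_projection_mem_unitaryGroup {n : Type*} [Fintype n] [DecidableEq n]
    {P : Matrix n n ℂ} (hP : P.IsHermitian) (hPP : P * P = P) {z : ℂ} (hz : z * star z = 1) :
    1 + (z - 1) • P ∈ Matrix.unitaryGroup n ℂ := by
  rw [mem_unitaryGroup_iff, star_eq_conjTranspose, conjTranspose_add, conjTranspose_smul, hP.eq,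
    conjTranspose_one, star_sub, star_one]
  simp only [mul_add, add_mul, mul_one, one_mul, smul_mul_smul_comm, hPP]
  rw [add_assoc, ← add_smul, ← add_smul]
  have : z - 1 + (star z - 1 + (z - 1) * (star z - 1)) = 0 := by linear_combination hz
  rw [this, zero_smul, add_zero]

/-- A subspace stable under conjugation by unitaries is stable under commutators. -/
lemma AdStable.of_conj_mem {n B : Type*} [Fintype n] [DecidableEq n] [Ring B] [Algebra ℂ B]
    (f : Matrix n n ℂ →ₗ[ℂ] B) (hf : f 1 = 1) {W : Submodule ℂ B}
    (hW : ∀ U ∈ Matrix.unitaryGroup n ℂ, ∀ T ∈ W, f U * T * f Uᴴ ∈ W) : AdStable f W := by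
  let S : Submodule ℂ (Matrix n n ℂ) :=
    { carrier := {Y | ∀ T ∈ W, f Y * T - T * f Y ∈ W}
      zero_mem' := fun T _ => by simp
      add_mem' := fun {X Y} hX hY T hT => by
        have := W.add_mem (hX T hT) (hY T hT)
        rw [map_add, add_mul, mul_add]
        convert this using 1
        abel
      smul_mem' := fun c X hX T hT => by
        have := W.smul_mem c (hX T hT)
        rwa [map_smul, smul_mul_assoc, mul_smul_comm, ← smul_sub] }
  intro Y
  refine Submodule.mem_of_projection_mem (S := S) (fun P hP hPP T hT => ?_) Y
  have key : ∀ z : ℂ, z * star z = 1 →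
      (1 + (z - 1) • f P) * T * (1 + (star z - 1) • f P) ∈ W := by
    intro z hz
    have := hW _ (one_add_smul_projection_mem_unitaryGroup hP hPP hz) T hT
    rwa [conjTranspose_add, conjTranspose_smul, hP.eq, conjTranspose_one, map_add, map_add,
      map_smul, map_smul, hf, star_sub, star_one] at this
  have h1 := key Complex.I (by simp)
  have h2 := key (-Complex.I) (by simp)
  have := W.smul_mem (-(Complex.I / 2)) (W.sub_mem h1 h2)
  convert this using 1
  have e : star Complex.I = -Complex.I := by simp
  rw [star_neg, e, neg_neg]
  simp only [add_mul, mul_add, one_mul, mul_one, smul_mul_assoc, mul_smul_comm, smul_smul,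
    smul_add, smul_sub]
  have hI : Complex.I * Complex.I = -1 := Complex.I_mul_I
  match_scalars <;> first | ring1 | linear_combination hI | linear_combination -hI

end Unitary

section SchmidtPair

lemma exists_int_bilinear_ne_zero {α β γ δ : ℂ} (hα : α ≠ 0) : ∃ s t : ℤ,
    α + s * β + t * γ + s * t * δ ≠ 0 ∧ s * t * α - s * γ - t * β + δ ≠ 0 := by
  by_contra! h
  have hδ : δ = 0 := by simpa [hα] using h 0 0
  subst hδ
  have h' : ∀ s t : ℤ, (α + s * β + t * γ) * (s * t * α - s * γ - t * β) = 0 := by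
    intro s t
    by_cases h0 : α + s * β + t * γ = 0
    · rw [h0, zero_mul]
    · have := h s t (by simpa using h0)
      rw [add_zero] at this
      rw [this, mul_zero]
  have hγ : γ = 0 := by
    have h1 := h' 1 0
    have h2 := h' (-1) 0
    push_cast at h1 h2
    have : α * γ = 0 := by linear_combination (-1 / 2 : ℂ) * h1 + (1 / 2 : ℂ) * h2
    simpa [hα] using this
  have hβ : β = 0 := by
    have h1 := h' 0 1
    have h2 := h' 0 (-1)
    push_cast at h1 h2
    have : α * β = 0 := by linear_combination (-1 / 2 : ℂ) * h1 + (1 / 2 : ℂ) * h2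
    simpa [hα] using this
  have := h' 1 1
  simp [hβ, hγ, hα] at this

lemma exists_orthogonal_product_pair {m n : Type*} [Fintype m] [Fintype n] [DecidableEq m]
    [DecidableEq n] [Nontrivial m] [Nontrivial n] {ψ : m × n → ℂ} (hψ : ψ ≠ 0) :
    ∃ (u₁ v₁ : m → ℂ) (u₂ v₂ : n → ℂ), v₁ ⬝ᵥ u₁ = 0 ∧ v₂ ⬝ᵥ u₂ = 0 ∧
      (fun p : m × n => v₁ p.1 * v₂ p.2) ⬝ᵥ ψ ≠ 0 ∧
      star ψ ⬝ᵥ (fun p : m × n => u₁ p.1 * u₂ p.2) ≠ 0 := by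
  obtain ⟨⟨i, j⟩, hij⟩ := Function.ne_iff.1 hψ
  obtain ⟨k, hk⟩ := exists_ne i
  obtain ⟨l, hl⟩ := exists_ne j
  obtain ⟨s, t, h1, h2⟩ := exists_int_bilinear_ne_zero (α := ψ (i, j)) (β := ψ (k, j))
    (γ := ψ (i, l)) (δ := ψ (k, l)) hij
  refine ⟨Pi.single k 1 - (s : ℂ) • Pi.single i 1, Pi.single i 1 + (s : ℂ) • Pi.single k 1,
    Pi.single l 1 - (t : ℂ) • Pi.single j 1, Pi.single j 1 + (t : ℂ) • Pi.single l 1,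
    ?_, ?_, ?_, ?_⟩
  · simp [dotProduct_sub, hk, hk.symm]
  · simp [dotProduct_sub, hl, hl.symm]
  · convert h1 using 1
    simp only [dotProduct, Fintype.sum_prod_type, Pi.add_apply, Pi.smul_apply, smul_eq_mul,
      Pi.single_apply]
    simp [add_mul, mul_add, Finset.sum_add_distrib]
    ring
  · intro h0
    apply h2
    have h0' := congrArg star h0
    rw [star_zero] at h0'
    rw [← h0']
    simp only [dotProduct, Fintype.sum_prod_type, Pi.sub_apply, Pi.smul_apply, smul_eq_mul,
      Pi.single_apply, Pi.star_apply]
    simp [sub_mul, mul_sub, Finset.sum_sub_distrib]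
    ring

lemma vecMulVec_ne_smul_one {n : Type*} [Fintype n] [DecidableEq n] {u v : n → ℂ}
    (hu : u ≠ 0) (hv : v ≠ 0) (h : v ⬝ᵥ u = 0) : ¬ ∃ c : ℂ, vecMulVec u v = c • 1 := by
  rintro ⟨c, hc⟩
  obtain ⟨i, hi⟩ := Function.ne_iff.1 hu
  obtain ⟨j, hj⟩ := Function.ne_iff.1 hv
  have hsq : vecMulVec u v * vecMulVec u v = 0 := by
    simp [vecMulVec_mul_vecMulVec, h]
  have hc0 : c = 0 := by
    have := congrFun (congrFun hsq i) i
    rw [hc] at this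
    simpa using this
  have := congrFun (congrFun hc i) j
  simp [hc0, vecMulVec_apply] at this
  exact this.elim hi hj

end SchmidtPair

section Kronecker

variable {m n : Type*} [Fintype m] [Fintype n] [DecidableEq m] [DecidableEq n]

/-- The linear map `A ↦ A ⊗ B`. -/
def kroneckerWith (B : Matrix n n ℂ) : Matrix m m ℂ →ₗ[ℂ] Matrix (m × n) (m × n) ℂ where
  toFun A := A ⊗ₖ B
  map_add' A A' := add_kronecker A A' B
  map_smul' c A := smul_kronecker c A B

/-- The linear map `B ↦ A ⊗ B`. -/
def withKronecker (A : Matrix m m ℂ) : Matrix n n ℂ →ₗ[ℂ] Matrix (m × n) (m × n) ℂ where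
  toFun B := A ⊗ₖ B
  map_add' B B' := kronecker_add A B B'
  map_smul' c B := kronecker_smul c A B

lemma AdStable.comap_kroneckerWith {W : Submodule ℂ (Matrix (m × n) (m × n) ℂ)}
    (hW : AdStable (kroneckerWith (m := m) (1 : Matrix n n ℂ)) W) (B : Matrix n n ℂ) :
    AdStable id (W.comap (kroneckerWith (m := m) B)) := by
  intro Y X hX
  rw [Submodule.mem_comap, map_sub]
  have := hW Y _ hX
  simpa [kroneckerWith, ← mul_kronecker_mul] using this

lemma AdStable.comap_withKronecker {W : Submodule ℂ (Matrix (m × n) (m × n) ℂ)}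
    (hW : AdStable (withKronecker (n := n) (1 : Matrix m m ℂ)) W) (A : Matrix m m ℂ) :
    AdStable id (W.comap (withKronecker (n := n) A)) := by
  intro Y X hX
  rw [Submodule.mem_comap, map_sub]
  have := hW Y _ hX
  simpa [withKronecker, ← mul_kronecker_mul] using this

lemma exists_traceless_kronecker_mem [Nontrivial m] [Nontrivial n] {ψ : m × n → ℂ} (hψ : ψ ≠ 0)
    {W : Submodule ℂ (Matrix (m × n) (m × n) ℂ)}
    (hW₁ : AdStable (kroneckerWith (m := m) (1 : Matrix n n ℂ)) W)
    (hW₂ : AdStable (withKronecker (n := n) (1 : Matrix m m ℂ)) W)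
    (hP : pureState ψ ∈ W) :
    ∃ (N₁ : Matrix m m ℂ) (N₂ : Matrix n n ℂ), N₁ ⊗ₖ N₂ ∈ W ∧ N₁.trace = 0 ∧
      (¬ ∃ c : ℂ, N₁ = c • 1) ∧ ¬ ∃ c : ℂ, N₂ = c • 1 := by
  obtain ⟨u₁, v₁, u₂, v₂, h1, h2, hv, hu⟩ := exists_orthogonal_product_pair hψ
  have hsq₁ : vecMulVec u₁ v₁ * vecMulVec u₁ v₁ = 0 := by simp [vecMulVec_mul_vecMulVec, h1]
  have hsq₂ : vecMulVec u₂ v₂ * vecMulVec u₂ v₂ = 0 := by simp [vecMulVec_mul_vecMulVec, h2]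
  refine ⟨vecMulVec u₁ v₁, vecMulVec u₂ v₂, ?_, ?_, vecMulVec_ne_smul_one ?_ ?_ h1,
    vecMulVec_ne_smul_one ?_ ?_ h2⟩
  · have hX := Submodule.sandwich_mem_of_sq_eq_zero (hW₁ (vecMulVec u₁ v₁))
      (by simp [kroneckerWith, ← mul_kronecker_mul, hsq₁]) hP
    have hY := Submodule.sandwich_mem_of_sq_eq_zero (hW₂ (vecMulVec u₂ v₂))
      (by simp [withKronecker, ← mul_kronecker_mul, hsq₂]) hX
    have e₁ : withKronecker (1 : Matrix m m ℂ) (vecMulVec u₂ v₂) *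
        kroneckerWith (1 : Matrix n n ℂ) (vecMulVec u₁ v₁) =
        vecMulVec u₁ v₁ ⊗ₖ vecMulVec u₂ v₂ := by
      simp [kroneckerWith, withKronecker, ← mul_kronecker_mul]
    have e₂ : kroneckerWith (1 : Matrix n n ℂ) (vecMulVec u₁ v₁) *
        withKronecker (1 : Matrix m m ℂ) (vecMulVec u₂ v₂) =
        vecMulVec u₁ v₁ ⊗ₖ vecMulVec u₂ v₂ := by
      simp [kroneckerWith, withKronecker, ← mul_kronecker_mul]
    rw [mul_assoc, mul_assoc, e₂, ← mul_assoc, ← mul_assoc, e₁] at hY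
    have e : vecMulVec u₁ v₁ ⊗ₖ vecMulVec u₂ v₂ =
        vecMulVec (fun p : m × n => u₁ p.1 * u₂ p.2) (fun p => v₁ p.1 * v₂ p.2) := by
      ext p q
      simp [vecMulVec_apply]
      ring
    rw [e] at hY ⊢
    rw [pureState, vecMulVec_mul_vecMulVec, vecMulVec_smul, smul_mul_assoc,
      vecMulVec_mul_vecMulVec, vecMulVec_smul] at hY
    exact (W.smul_mem_iff hu).1 ((W.smul_mem_iff hv).1 hY)
  · rw [trace_vecMulVec, dotProduct_comm, h1]
  · rintro rfl; exact hu (by simp [dotProduct])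
  · rintro rfl; exact hv (by simp [dotProduct])
  · rintro rfl; exact hu (by simp [dotProduct])
  · rintro rfl; exact hv (by simp [dotProduct])

lemma kronecker_one_mem_of_conj {d : ℕ} [NeZero d]
    {W : Submodule ℂ (Matrix (m × Fin d) (m × Fin d) ℂ)}
    (hW : ∀ V ∈ Matrix.unitaryGroup (Fin d) ℂ, ∀ T ∈ W,
      ((1 : Matrix m m ℂ) ⊗ₖ V) * T * (1 ⊗ₖ V)ᴴ ∈ W)
    {T : Matrix (m × Fin d) (m × Fin d) ℂ} (hT : T ∈ W) :
    partialTraceRight T ⊗ₖ (1 : Matrix (Fin d) (Fin d) ℂ) ∈ W := by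
  obtain ⟨ι, _, _, V, hV, hsum⟩ := exists_unitary_twirl d
  have h := W.sum_mem fun l (_ : l ∈ Finset.univ) => hW _ (hV l) T hT
  rw [sum_conj_one_kronecker hsum] at h
  exact (W.smul_mem_iff (by simp [NeZero.ne])).1 h

lemma one_kronecker_mem_of_conj {d : ℕ} [NeZero d]
    {W : Submodule ℂ (Matrix (Fin d × n) (Fin d × n) ℂ)}
    (hW : ∀ U ∈ Matrix.unitaryGroup (Fin d) ℂ, ∀ T ∈ W,
      (U ⊗ₖ (1 : Matrix n n ℂ)) * T * (U ⊗ₖ 1)ᴴ ∈ W)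
    {T : Matrix (Fin d × n) (Fin d × n) ℂ} (hT : T ∈ W) :
    (1 : Matrix (Fin d) (Fin d) ℂ) ⊗ₖ partialTraceLeft T ∈ W := by
  obtain ⟨ι, _, _, U, hU, hsum⟩ := exists_unitary_twirl d
  have h := W.sum_mem fun l (_ : l ∈ Finset.univ) => hW _ (hU l) T hT
  rw [sum_conj_kronecker_one hsum] at h
  exact (W.smul_mem_iff (by simp [NeZero.ne])).1 h

end Kronecker

/-- A subspace stable under local unitaries which contains `1` and a pure state whose reduced
states are not maximally mixed is the whole matrix algebra. -/
lemma mem_of_conj_mem_of_pureState_mem {d₁ d₂ : ℕ} (h₁ : 1 < d₁) (h₂ : 1 < d₂)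
    {ψ : Fin d₁ × Fin d₂ → ℂ} (hψ : ψ ≠ 0)
    {W : Submodule ℂ (Matrix (Fin d₁ × Fin d₂) (Fin d₁ × Fin d₂) ℂ)}
    (hW : ∀ U ∈ Matrix.unitaryGroup (Fin d₁) ℂ, ∀ V ∈ Matrix.unitaryGroup (Fin d₂) ℂ,
      ∀ T ∈ W, (U ⊗ₖ V) * T * (U ⊗ₖ V)ᴴ ∈ W)
    (hone : 1 ∈ W) (hP : pureState ψ ∈ W)
    (hR : ¬ ∃ c : ℂ, partialTraceRight (pureState ψ) = c • 1)
    (hL : ¬ ∃ c : ℂ, partialTraceLeft (pureState ψ) = c • 1)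
    (T : Matrix (Fin d₁ × Fin d₂) (Fin d₁ × Fin d₂) ℂ) : T ∈ W := by
  have : NeZero d₁ := ⟨by lia⟩
  have : NeZero d₂ := ⟨by lia⟩
  have : Nontrivial (Fin d₁) := Fin.nontrivial_iff_two_le.2 h₁
  have : Nontrivial (Fin d₂) := Fin.nontrivial_iff_two_le.2 h₂
  have hW₁ : AdStable (kroneckerWith (m := Fin d₁) (1 : Matrix (Fin d₂) (Fin d₂) ℂ)) W :=
    AdStable.of_conj_mem _ one_kronecker_one fun U hU T hT => by
      simpa [kroneckerWith, conjTranspose_kronecker] using hW U hU 1 (one_mem _) T hT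
  have hW₂ : AdStable (withKronecker (n := Fin d₂) (1 : Matrix (Fin d₁) (Fin d₁) ℂ)) W :=
    AdStable.of_conj_mem _ one_kronecker_one fun V hV T hT => by
      simpa [withKronecker, conjTranspose_kronecker] using hW 1 (one_mem _) V hV T hT
  have hone' : (1 : Matrix (Fin d₁) (Fin d₁) ℂ) ⊗ₖ (1 : Matrix (Fin d₂) (Fin d₂) ℂ) ∈ W := by
    rwa [one_kronecker_one]
  have hleft : ∀ A : Matrix (Fin d₁) (Fin d₁) ℂ, A ⊗ₖ (1 : Matrix (Fin d₂) (Fin d₂) ℂ) ∈ W :=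
    (hW₁.comap_kroneckerWith 1).mem_of_one_mem
      (kronecker_one_mem_of_conj (fun V hV => hW 1 (one_mem _) V hV) hP) hR hone'
  have hright : ∀ B : Matrix (Fin d₂) (Fin d₂) ℂ, (1 : Matrix (Fin d₁) (Fin d₁) ℂ) ⊗ₖ B ∈ W :=
    (hW₂.comap_withKronecker 1).mem_of_one_mem
      (one_kronecker_mem_of_conj (fun U hU => hW U hU 1 (one_mem _)) hP) hL hone'
  obtain ⟨N₁, N₂, hN, htr, hN₁, hN₂⟩ := exists_traceless_kronecker_mem hψ hW₁ hW₂ hP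
  have hNB : ∀ B, N₁ ⊗ₖ B ∈ W :=
    (hW₂.comap_withKronecker N₁).mem_of_one_mem hN hN₂ (hleft N₁)
  induction T using Matrix.kronecker_induction with
  | hadd S T hS hT => exact W.add_mem hS hT
  | hkron A B =>
    exact (hW₁.comap_kroneckerWith B).mem_of_one_mem (hNB B) hN₁ (hright B) A

section MaxEnt

lemma maxEnt_of_partialTraceLeft_eq {d₁ d₂ : ℕ} {ψ : Fin d₁ × Fin d₂ → ℂ} (hψ : IsUnitVec ψ)
    (h : ∃ c : ℂ, partialTraceLeft (pureState ψ) = c • 1) : MaxEnt d₁ d₂ ψ := by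
  obtain ⟨c, hc⟩ := h
  have hcd : c * d₂ = 1 := by
    have := congrArg trace hc
    rw [trace_smul, trace_one, Fintype.card_fin, smul_eq_mul] at this
    rw [← this, trace]
    simp only [diag_apply, partialTraceLeft, of_apply, pureState, vecMulVec_apply, Pi.star_apply,
      Complex.star_def, Complex.mul_conj]
    rw [Finset.sum_comm, ← Fintype.sum_prod_type' (f := fun i k => (Complex.normSq (ψ (i, k)) : ℂ))]
    exact_mod_cast hψ
  have hd : (d₂ : ℂ) ≠ 0 := right_ne_zero_of_mul_eq_one hcd
  have hs : ((Real.sqrt d₂ : ℝ) : ℂ) * (Real.sqrt d₂ : ℝ) = d₂ := by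
    rw [← Complex.ofReal_mul, Real.mul_self_sqrt (Nat.cast_nonneg _), Complex.ofReal_natCast]
  refine ⟨fun j i => Real.sqrt d₂ * ψ (i, j), fun j => Pi.single j 1, fun i j => ?_, fun i j => ?_,
    fun p => ?_⟩
  · have := congrFun (congrFun hc j) i
    simp only [partialTraceLeft, of_apply, pureState, vecMulVec_apply, Pi.star_apply,
      Matrix.smul_apply, one_apply, smul_eq_mul, Complex.star_def] at this
    have e : ∀ p, (starRingEnd ℂ) (Real.sqrt d₂ * ψ (p, i)) * (Real.sqrt d₂ * ψ (p, j)) =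
        d₂ * (ψ (p, j) * (starRingEnd ℂ) (ψ (p, i))) := by
      intro p
      rw [map_mul, Complex.conj_ofReal, ← hs]
      ring
    simp only [e, ← Finset.mul_sum, this, eq_comm (a := j)]
    split_ifs
    · linear_combination hcd
    · simp
  · simp [Pi.single_apply, eq_comm]
  · have hs0 : ((Real.sqrt d₂ : ℝ) : ℂ) ≠ 0 := left_ne_zero_of_mul (hs.trans_ne hd)
    simp [Pi.single_apply, hs0]

lemma partialTraceLeft_eq_of_partialTraceRight_eq {d₁ d₂ : ℕ} (hd : d₂ ≤ d₁)
    {ψ : Fin d₁ × Fin d₂ → ℂ} (hψ : ψ ≠ 0)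
    (h : ∃ c : ℂ, partialTraceRight (pureState ψ) = c • 1) :
    ∃ c : ℂ, partialTraceLeft (pureState ψ) = c • 1 := by
  obtain ⟨c, hc⟩ := h
  let Ψ : Matrix (Fin d₁) (Fin d₂) ℂ := of fun i k => ψ (i, k)
  have hR : Ψ * Ψᴴ = c • 1 := by
    rw [← hc]
    ext i j
    simp [Ψ, mul_apply, partialTraceRight, pureState, vecMulVec_apply]
  have hL : partialTraceLeft (pureState ψ) = (Ψᴴ * Ψ)ᵀ := by
    ext k l
    simp [Ψ, mul_apply, partialTraceLeft, pureState, vecMulVec_apply, mul_comm]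
  have hc0 : c ≠ 0 := by
    rintro rfl
    rw [zero_smul, self_mul_conjTranspose_eq_zero] at hR
    exact hψ (funext fun p => congrFun (congrFun hR p.1) p.2)
  have hinv : (c⁻¹ • Ψ) * Ψᴴ = 1 := by
    rw [Matrix.smul_mul, hR, smul_smul, inv_mul_cancel₀ hc0, one_smul]
  have hle : d₁ ≤ d₂ := by
    have h1 := rank_mul_le_left (c⁻¹ • Ψ) Ψᴴ
    rw [hinv, rank_one, Fintype.card_fin] at h1
    exact h1.trans (rank_le_width _)
  obtain rfl := le_antisymm hd hle
  refine ⟨c, ?_⟩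
  have h1 := mul_eq_one_comm.1 hinv
  rw [Matrix.mul_smul] at h1
  have h2 : Ψᴴ * Ψ = c • 1 := by rw [← h1, smul_smul, mul_inv_cancel₀ hc0, one_smul]
  rw [hL, h2, transpose_smul, transpose_one]

end MaxEnt

section Convex

lemma interior_preimage_convexHull_nonempty_of_basis {N ι : Type*} [Fintype N] [DecidableEq N]
    [Fintype ι] [Nonempty ι] (b : Module.Basis ι ℂ (Matrix N N ℂ))
    {s : Set (Matrix N N ℂ)} (hbs : ∀ i, b i ∈ s)
    (hb : ∀ i, (b i).IsHermitian ∧ (b i).trace = 1) :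
    (interior ((Subtype.val : traceOne N → Matrix N N ℂ) ⁻¹' (convexHull ℝ s))).Nonempty := by
  have hcard : (Fintype.card ι : ℂ) ≠ 0 := Nat.cast_ne_zero.2 Fintype.card_ne_zero
  have hx : (Fintype.card ι : ℂ)⁻¹ • ∑ i, b i ∈ traceOne N := by
    constructor
    · rw [IsHermitian, conjTranspose_smul, conjTranspose_sum, star_inv₀, star_natCast]
      simp only [(hb _).1.eq]
    · simp [trace_sum, (hb _).2, hcard]
  refine ⟨⟨_, hx⟩, mem_interior.2 ⟨{A | ∀ i, 0 < (b.repr A.1 i).re}, ?_, ?_, ?_⟩⟩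
  · rintro ⟨A, hA, htr⟩ hpos
    have hsum : A = ∑ i, (b.repr A i).re • b i := by
      have h1 := b.sum_repr A
      have h2 : ∑ i, star (b.repr A i) • b i = A := by
        have := congrArg conjTranspose h1
        rw [conjTranspose_sum, hA.eq] at this
        simpa only [conjTranspose_smul, (hb _).1.eq] using this
      calc A = (1 / 2 : ℂ) • (A + A) := by module
        _ = (1 / 2 : ℂ) • (∑ i, b.repr A i • b i + ∑ i, star (b.repr A i) • b i) := by
          rw [h1, h2]
        _ = _ := by
          rw [← Finset.sum_add_distrib, Finset.smul_sum]
          refine Finset.sum_congr rfl fun i _ => ?_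
          rw [← add_smul, smul_smul, Complex.star_def, Complex.add_conj,
            ← Complex.coe_smul (b.repr A i).re]
          congr 1
          push_cast
          ring
    change A ∈ convexHull ℝ s
    rw [hsum]
    refine (convex_convexHull ℝ s).sum_mem (fun i _ => (hpos i).le) ?_
      fun i _ => subset_convexHull ℝ s (hbs i)
    have h := congrArg trace hsum
    rw [htr, trace_sum] at h
    simp only [trace_smul, (hb _).2, Complex.real_smul, mul_one] at h
    exact_mod_cast h.symm
  · simp only [Set.ofPred_forall]
    refine isOpen_iInter_of_finite fun i => isOpen_lt continuous_const ?_
    exact Complex.continuous_re.comp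
      ((b.coord i).continuous_of_finiteDimensional.comp continuous_subtype_val)
  · intro i
    have : b.repr ((Fintype.card ι : ℂ)⁻¹ • ∑ i, b i) i = ((Fintype.card ι : ℝ)⁻¹ : ℝ) := by
      simp
    rw [this, Complex.ofReal_re]
    have : 0 < Fintype.card ι := Fintype.card_pos
    positivity

lemma interior_preimage_convexHull_nonempty {N : Type*} [Fintype N] [DecidableEq N] [Nonempty N]
    {s : Set (Matrix N N ℂ)} (hs : ∀ A ∈ s, A.IsHermitian ∧ A.trace = 1)
    (hspan : Submodule.span ℂ s = ⊤) :
    (interior ((Subtype.val : traceOne N → Matrix N N ℂ) ⁻¹' (convexHull ℝ s))).Nonempty := by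
  let b := Module.Basis.ofSpan hspan.ge
  have hb : ∀ i, b i ∈ s := fun i => Module.Basis.ofSpan_subset hspan.ge ⟨i, rfl⟩
  have := FiniteDimensional.fintypeBasisIndex b
  have := b.index_nonempty
  exact interior_preimage_convexHull_nonempty_of_basis b hb fun i => hs _ (hb i)

end Convex

section LocalOrbit

variable {d₁ d₂ : ℕ}

lemma kronecker_mem_unitaryGroup {m n : Type*} [Fintype m] [Fintype n] [DecidableEq m]
    [DecidableEq n] {U : Matrix m m ℂ} {V : Matrix n n ℂ} (hU : U ∈ Matrix.unitaryGroup m ℂ)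
    (hV : V ∈ Matrix.unitaryGroup n ℂ) : U ⊗ₖ V ∈ Matrix.unitaryGroup (m × n) ℂ := by
  rw [mem_unitaryGroup_iff, star_eq_conjTranspose] at *
  rw [conjTranspose_kronecker, ← mul_kronecker_mul, hU, hV, one_kronecker_one]

lemma conj_mem_localOrbit {A B : Matrix (Fin d₁ × Fin d₂) (Fin d₁ × Fin d₂) ℂ}
    (hB : B ∈ localOrbit d₁ d₂ A) {U : Matrix (Fin d₁) (Fin d₁) ℂ}
    (hU : U ∈ Matrix.unitaryGroup (Fin d₁) ℂ) {V : Matrix (Fin d₂) (Fin d₂) ℂ}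
    (hV : V ∈ Matrix.unitaryGroup (Fin d₂) ℂ) :
    (U ⊗ₖ V) * B * (U ⊗ₖ V)ᴴ ∈ localOrbit d₁ d₂ A := by
  obtain ⟨U', hU', V', hV', rfl⟩ := hB
  refine ⟨U * U', mul_mem hU hU', V * V', mul_mem hV hV', ?_⟩
  rw [mul_kronecker_mul, conjTranspose_mul]
  simp only [Matrix.mul_assoc]

lemma self_mem_localOrbit (A : Matrix (Fin d₁ × Fin d₂) (Fin d₁ × Fin d₂) ℂ) :
    A ∈ localOrbit d₁ d₂ A :=
  ⟨1, one_mem _, 1, one_mem _, by simp⟩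

lemma conj_mem_convexHull_localOrbit {A B : Matrix (Fin d₁ × Fin d₂) (Fin d₁ × Fin d₂) ℂ}
    (hB : B ∈ convexHull ℝ (localOrbit d₁ d₂ A)) {U : Matrix (Fin d₁) (Fin d₁) ℂ}
    (hU : U ∈ Matrix.unitaryGroup (Fin d₁) ℂ) {V : Matrix (Fin d₂) (Fin d₂) ℂ}
    (hV : V ∈ Matrix.unitaryGroup (Fin d₂) ℂ) :
    (U ⊗ₖ V) * B * (U ⊗ₖ V)ᴴ ∈ convexHull ℝ (localOrbit d₁ d₂ A) := by
  let f := LinearMap.mulLeft ℝ (U ⊗ₖ V) ∘ₗ LinearMap.mulRight ℝ (U ⊗ₖ V)ᴴ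
  have : convexHull ℝ (localOrbit d₁ d₂ A) ⊆ f ⁻¹' convexHull ℝ (localOrbit d₁ d₂ A) :=
    convexHull_min (fun C hC => subset_convexHull ℝ _ <| by
      simpa [f, mul_assoc] using conj_mem_localOrbit hC hU hV)
      ((convex_convexHull ℝ _).linear_preimage f)
  simpa [f, mul_assoc] using this hB

lemma conj_mem_span_localOrbit {A B : Matrix (Fin d₁ × Fin d₂) (Fin d₁ × Fin d₂) ℂ}
    (hB : B ∈ Submodule.span ℂ (localOrbit d₁ d₂ A)) {U : Matrix (Fin d₁) (Fin d₁) ℂ}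
    (hU : U ∈ Matrix.unitaryGroup (Fin d₁) ℂ) {V : Matrix (Fin d₂) (Fin d₂) ℂ}
    (hV : V ∈ Matrix.unitaryGroup (Fin d₂) ℂ) :
    (U ⊗ₖ V) * B * (U ⊗ₖ V)ᴴ ∈ Submodule.span ℂ (localOrbit d₁ d₂ A) := by
  let f := LinearMap.mulLeft ℂ (U ⊗ₖ V) ∘ₗ LinearMap.mulRight ℂ (U ⊗ₖ V)ᴴ
  have : Submodule.span ℂ (localOrbit d₁ d₂ A) ≤
      (Submodule.span ℂ (localOrbit d₁ d₂ A)).comap f :=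
    Submodule.span_le.2 fun C hC => Submodule.subset_span <| by
      simpa [f, mul_assoc] using conj_mem_localOrbit hC hU hV
  simpa [f, mul_assoc] using this hB

lemma convexHull_subset_span (s : Set (Matrix (Fin d₁ × Fin d₂) (Fin d₁ × Fin d₂) ℂ)) :
    convexHull ℝ s ⊆ Submodule.span ℂ s :=
  convexHull_min Submodule.subset_span ((Submodule.span ℂ s).restrictScalars ℝ).convex

lemma convex_posSemidef_trace_one (N : Type*) [Fintype N] :
    Convex ℝ {A : Matrix N N ℂ | A.PosSemidef ∧ A.trace = 1} := by
  rintro A ⟨hA, hA1⟩ B ⟨hB, hB1⟩ a b ha hb hab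
  refine ⟨?_, ?_⟩
  · rw [← Complex.coe_smul a, ← Complex.coe_smul b]
    exact (hA.smul (by exact_mod_cast ha)).add (hB.smul (by exact_mod_cast hb))
  · rw [trace_add, trace_smul, trace_smul, hA1, hB1, ← add_smul, hab, one_smul]

lemma posSemidef_and_trace_of_mem_localOrbit
    {A B : Matrix (Fin d₁ × Fin d₂) (Fin d₁ × Fin d₂) ℂ} (hA : A.PosSemidef)
    (hB : B ∈ localOrbit d₁ d₂ A) : B.PosSemidef ∧ B.trace = A.trace := by
  obtain ⟨U, hU, V, hV, rfl⟩ := hB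
  refine ⟨hA.mul_mul_conjTranspose_same _, ?_⟩
  have := mem_unitaryGroup_iff'.1 (kronecker_mem_unitaryGroup hU hV)
  rw [star_eq_conjTranspose] at this
  rw [trace_mul_cycle, this, one_mul]

lemma smul_one_mem_convexHull_localOrbit [NeZero d₁] [NeZero d₂]
    {A : Matrix (Fin d₁ × Fin d₂) (Fin d₁ × Fin d₂) ℂ} (hA : A.trace = 1) :
    (((d₁ * d₂ : ℕ) : ℂ))⁻¹ • 1 ∈ convexHull ℝ (localOrbit d₁ d₂ A) := by
  obtain ⟨ι, _, _, U, hU, hUs⟩ := exists_unitary_twirl d₁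
  obtain ⟨κ, _, _, V, hV, hVs⟩ := exists_unitary_twirl d₂
  have hsum := sum_conj_kronecker_eq_smul_one hUs hVs A
  rw [hA, ← Fintype.sum_prod_type' (f := fun k l => (U k ⊗ₖ V l) * A * (U k ⊗ₖ V l)ᴴ)] at hsum
  have hι : (Fintype.card ι : ℂ) ≠ 0 := Nat.cast_ne_zero.2 Fintype.card_ne_zero
  have hκ : (Fintype.card κ : ℂ) ≠ 0 := Nat.cast_ne_zero.2 Fintype.card_ne_zero
  have h := (convex_convexHull ℝ (localOrbit d₁ d₂ A)).sum_mem
    (t := Finset.univ) (w := fun _ : ι × κ => (Fintype.card (ι × κ) : ℝ)⁻¹)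
    (z := fun p => (U p.1 ⊗ₖ V p.2) * A * (U p.1 ⊗ₖ V p.2)ᴴ)
    (fun _ _ => by positivity)
    (by rw [Finset.sum_const, Finset.card_univ, nsmul_eq_mul]
        exact mul_inv_cancel₀ (Nat.cast_ne_zero.2 Fintype.card_ne_zero)) fun p _ =>
      subset_convexHull ℝ _ (conj_mem_localOrbit (self_mem_localOrbit A) (hU _) (hV _))
  rw [← Finset.smul_sum, hsum, ← Complex.coe_smul, smul_smul] at h
  convert h using 2
  have h1 : (d₁ : ℂ) ≠ 0 := NeZero.ne _
  have h2 : (d₂ : ℂ) ≠ 0 := NeZero.ne _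
  push_cast [Fintype.card_prod]
  field_simp

end LocalOrbit

lemma IsUnitVec.trace_pureState {n : Type*} [Fintype n] {ψ : n → ℂ} (hψ : IsUnitVec ψ) :
    (pureState ψ).trace = 1 := by
  rw [pureState, trace_vecMulVec, dotProduct]
  simp only [Pi.star_apply, Complex.star_def, Complex.mul_conj]
  exact_mod_cast hψ

lemma IsUnitVec.ne_zero {n : Type*} [Fintype n] {ψ : n → ℂ} (hψ : IsUnitVec ψ) : ψ ≠ 0 := by
  rintro rfl
  simp [IsUnitVec] at hψ

/-- for `dim H₁ = d₁ ≥ dim H₂ = d₂ > 1` and a unit vector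
`ψ ∈ H = H₁ ⊗ H₂`, the convexed local orbit `C_ψ = Conv(K·P_ψ)` of `P_ψ` under
`K = U(H₁) × U(H₂)` satisfies: (i) `C_ψ` is `K`-invariant; (ii) `C_ψ` consists of density
states; (iii) `𝕀_H = I/(d₁d₂) ∈ C_ψ`; (iv) if `ψ` is not maximally entangled then `C_ψ`
has nonempty interior in the affine space `u*₁(H)` of trace-one Hermitian operators. -/
theorem stmt10 (d₁ d₂ : ℕ) (hd : d₂ ≤ d₁) (h2 : 1 < d₂)
    (ψ : Fin d₁ × Fin d₂ → ℂ) (hψ : IsUnitVec ψ) :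
    (∀ U₁ ∈ Matrix.unitaryGroup (Fin d₁) ℂ, ∀ U₂ ∈ Matrix.unitaryGroup (Fin d₂) ℂ,
      ∀ A ∈ convexHull ℝ (localOrbit d₁ d₂ (pureState ψ)),
        (U₁ ⊗ₖ U₂) * A * (U₁ ⊗ₖ U₂)ᴴ ∈ convexHull ℝ (localOrbit d₁ d₂ (pureState ψ))) ∧
    (∀ A ∈ convexHull ℝ (localOrbit d₁ d₂ (pureState ψ)), A.PosSemidef ∧ A.trace = 1) ∧
    (((d₁ * d₂ : ℕ) : ℂ))⁻¹ • 1 ∈ convexHull ℝ (localOrbit d₁ d₂ (pureState ψ)) ∧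
    (¬ MaxEnt d₁ d₂ ψ →
      (interior ((Subtype.val :
          traceOne (Fin d₁ × Fin d₂) → Matrix (Fin d₁ × Fin d₂) (Fin d₁ × Fin d₂) ℂ) ⁻¹'
        (convexHull ℝ (localOrbit d₁ d₂ (pureState ψ))))).Nonempty) := by
  have : NeZero d₁ := ⟨by lia⟩
  have : NeZero d₂ := ⟨by lia⟩
  have hpos : (pureState ψ).PosSemidef := posSemidef_vecMulVec_self_star ψ
  have horbit : ∀ A ∈ localOrbit d₁ d₂ (pureState ψ), A.PosSemidef ∧ A.trace = 1 := fun A hA => by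
    rw [← hψ.trace_pureState]
    exact posSemidef_and_trace_of_mem_localOrbit hpos hA
  have hone := smul_one_mem_convexHull_localOrbit (d₁ := d₁) (d₂ := d₂) hψ.trace_pureState
  refine ⟨fun U hU V hV A hA => conj_mem_convexHull_localOrbit hA hU hV,
    fun A hA => convexHull_min horbit (convex_posSemidef_trace_one _) hA, hone, fun hmax => ?_⟩
  have hL : ¬ ∃ c : ℂ, partialTraceLeft (pureState ψ) = c • 1 :=
    fun h => hmax (maxEnt_of_partialTraceLeft_eq hψ h)
  have hR : ¬ ∃ c : ℂ, partialTraceRight (pureState ψ) = c • 1 :=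
    fun h => hL (partialTraceLeft_eq_of_partialTraceRight_eq hd hψ.ne_zero h)
  refine interior_preimage_convexHull_nonempty
    (fun A hA => ⟨(horbit A hA).1.isHermitian, (horbit A hA).2⟩) ?_
  refine (Submodule.eq_top_iff').2 (mem_of_conj_mem_of_pureState_mem (h2.trans_le hd) h2 hψ.ne_zero
    (fun U hU V hV T hT => conj_mem_span_localOrbit hT hU hV) ?_
    (Submodule.subset_span (self_mem_localOrbit _)) hR hL)
  refine (Submodule.smul_mem_iff _ ?_).1 (convexHull_subset_span _ hone)
  simp [NeZero.ne]

end
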